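/- Let m : ℕ → ℕ and set ζ(n) := (2·m(n) − 2n)·n^{−3/5}. Suppose ζ(n) → c for some constant c ∈ ℝ. If l₀ : ℕ → ℝ is such that for every sufficiently large n, l₀(n) solves the excess equation for (n, m(n)), then there exist constants c₁, c₂, c₃, c₄ > 0 such that for all sufficiently large n: c₁·n^{3/5} ≤ l₀(n) ≤ c₂·n^{3/5}, and moreover 0 < l₀(n) − ζ(n)·n^{3/5}/2 and c₃·n^{3/5} ≤ l₀(n) − ζ(n)·n^{3/5}/2 ≤ c₄·n^{3/5}. -/

import Mathlib

open Filter

/-- The constant γ = 79^(3/4)/54^(1/2). -/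
noncomputable def gammaK : ℝ := (79 : ℝ) ^ ((3 : ℝ) / 4) / (54 : ℝ) ^ ((1 : ℝ) / 2)

/-- The constant φ = 2·√e·γ²·3^(−3/2). -/
noncomputable def phiC : ℝ := 2 * Real.sqrt (Real.exp 1) * gammaK ^ 2 * (3 : ℝ) ^ (-(3 : ℝ) / 2)

/-- `l₀` solves the excess equation for `(n, m)`: it lies strictly between
`max 0 (m − n)` and `m − n/2` and satisfies
`l₀ · e^(1/3) · 2^(4/3) · (n − m + l₀)^(2/3) = φ^(2/3) · (2m − n − 2l₀)`. -/
def SolvesExcessEq (n m l₀ : ℝ) : Prop :=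
  max 0 (m - n) < l₀ ∧ l₀ < m - n / 2 ∧
    l₀ * Real.exp 1 ^ ((1 : ℝ) / 3) * (2 : ℝ) ^ ((4 : ℝ) / 3) * (n - m + l₀) ^ ((2 : ℝ) / 3)
      = phiC ^ ((2 : ℝ) / 3) * (2 * m - n - 2 * l₀)

lemma aux_bounds (A B K x d e : ℝ) (hA : 0 < A) (hB : 0 < B) (hK : 0 < K)
    (hx : 0 < x) (hd : 0 < d) (hxd : |x - d| ≤ K) (he : 0 ≤ e)
    (hM : 4 * (1 + K + B / A) * e ≤ 1)
    (heq : A * x * d ^ ((2 : ℝ) / 3) = B * (1 - 2 * d * e)) :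
    B / (2 * A * (1 + K + B / A) ^ ((2 : ℝ) / 3)) ≤ x ∧ x ≤ (1 + K + B / A) + K ∧
    (B / (2 * A * ((1 + K + B / A) + K))) ^ ((3 : ℝ) / 2) ≤ d ∧ d ≤ 1 + K + B / A := by
  have hBA : 0 < B / A := div_pos hB hA
  obtain ⟨h1, h2⟩ := abs_le.mp hxd
  have hdM : d ≤ 1 + K + B / A := by
    by_contra hcon
    push Not at hcon
    have hd1 : (1 : ℝ) ≤ d ^ ((2 : ℝ) / 3) := Real.one_le_rpow (by linarith) (by norm_num)
    have hx1 : 1 + B / A ≤ x := by linarith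
    have h3 : A * (1 + B / A) ≤ A * x := mul_le_mul_of_nonneg_left hx1 hA.le
    have h4 : A * (1 + B / A) = A + B := by field_simp
    have h5 : A * x * 1 ≤ A * x * d ^ ((2 : ℝ) / 3) :=
      mul_le_mul_of_nonneg_left hd1 (by positivity)
    have h6 : 0 ≤ B * (d * e) := by positivity
    nlinarith
  set M := 1 + K + B / A with hMdef
  have hMpos : 0 < M := by positivity
  have hde : d * e ≤ M * e := mul_le_mul_of_nonneg_right hdM he
  have hlow : B / 2 ≤ A * x * d ^ ((2 : ℝ) / 3) := by
    rw [heq]; nlinarith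
  have hxM : x ≤ M + K := by linarith
  refine ⟨?_, hxM, ?_, hdM⟩
  · rw [div_le_iff₀ (by positivity)]
    have h5 : A * x * d ^ ((2 : ℝ) / 3) ≤ A * x * M ^ ((2 : ℝ) / 3) :=
      mul_le_mul_of_nonneg_left (Real.rpow_le_rpow hd.le hdM (by norm_num)) (by positivity)
    linarith
  · have h7 : B / (2 * A * (M + K)) ≤ d ^ ((2 : ℝ) / 3) := by
      rw [div_le_iff₀ (by positivity)]
      have h8 : (A * d ^ ((2 : ℝ) / 3)) * x ≤ (A * d ^ ((2 : ℝ) / 3)) * (M + K) :=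
        mul_le_mul_of_nonneg_left hxM (by positivity)
      linarith
    calc _ ≤ (d ^ ((2 : ℝ) / 3)) ^ ((3 : ℝ) / 2) :=
          Real.rpow_le_rpow (by positivity) h7 (by norm_num)
      _ = d := by
          rw [← Real.rpow_mul hd.le]; norm_num

theorem stmt8 (m : ℕ → ℕ) (l₀ : ℕ → ℝ) (c : ℝ)
    (hzeta : Tendsto (fun n : ℕ => ((2 * m n : ℝ) - 2 * n) * (n : ℝ) ^ (-(3 : ℝ) / 5))
      atTop (nhds c))
    (hl : ∀ᶠ n : ℕ in atTop, SolvesExcessEq n (m n) (l₀ n)) :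
    ∃ c₁ c₂ c₃ c₄ : ℝ, 0 < c₁ ∧ 0 < c₂ ∧ 0 < c₃ ∧ 0 < c₄ ∧ ∀ᶠ n : ℕ in atTop,
      (c₁ * (n : ℝ) ^ ((3 : ℝ) / 5) ≤ l₀ n ∧ l₀ n ≤ c₂ * (n : ℝ) ^ ((3 : ℝ) / 5)) ∧
      0 < l₀ n - (((2 * m n : ℝ) - 2 * n) * (n : ℝ) ^ (-(3 : ℝ) / 5)) * (n : ℝ) ^ ((3 : ℝ) / 5) / 2 ∧
      c₃ * (n : ℝ) ^ ((3 : ℝ) / 5) ≤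
        l₀ n - (((2 * m n : ℝ) - 2 * n) * (n : ℝ) ^ (-(3 : ℝ) / 5)) * (n : ℝ) ^ ((3 : ℝ) / 5) / 2 ∧
      l₀ n - (((2 * m n : ℝ) - 2 * n) * (n : ℝ) ^ (-(3 : ℝ) / 5)) * (n : ℝ) ^ ((3 : ℝ) / 5) / 2 ≤
        c₄ * (n : ℝ) ^ ((3 : ℝ) / 5) := by
  have hphi : 0 < phiC := by unfold phiC gammaK; positivity
  set A : ℝ := Real.exp 1 ^ ((1 : ℝ) / 3) * (2 : ℝ) ^ ((4 : ℝ) / 3) with hAdef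
  have hA : 0 < A := by positivity
  set B : ℝ := phiC ^ ((2 : ℝ) / 3) with hBdef
  have hB : 0 < B := Real.rpow_pos_of_pos hphi _
  set K : ℝ := |c| + 1 with hKdef
  have hK : 0 < K := by positivity
  have hBA : 0 < B / A := div_pos hB hA
  have hMpos : 0 < 1 + K + B / A := by positivity
  have hZ : ∀ᶠ n : ℕ in atTop,
      |((2 * m n : ℝ) - 2 * n) * (n : ℝ) ^ (-(3 : ℝ) / 5)| < K :=
    hzeta.abs.eventually_lt_const (by rw [hKdef]; linarith)
  have hE : ∀ᶠ n : ℕ in atTop,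
      (n : ℝ) ^ (-((2 : ℝ) / 5)) < 1 / (4 * (1 + K + B / A)) :=
    ((tendsto_rpow_neg_atTop (by norm_num : (0 : ℝ) < 2 / 5)).comp
      tendsto_natCast_atTop_atTop).eventually_lt_const (by positivity)
  refine ⟨B / (2 * A * (1 + K + B / A) ^ ((2 : ℝ) / 3)), (1 + K + B / A) + K,
    (B / (2 * A * ((1 + K + B / A) + K))) ^ ((3 : ℝ) / 2), 1 + K + B / A,
    by positivity, by positivity, by positivity, by positivity, ?_⟩
  filter_upwards [hl, hZ, hE, eventually_gt_atTop 0] with n hn hz he hn0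
  have hN : (0 : ℝ) < n := by exact_mod_cast hn0
  obtain ⟨hlo, -, heq⟩ := hn
  obtain ⟨hl0, hlm⟩ := max_lt_iff.mp hlo
  have hT : (0 : ℝ) < (n : ℝ) ^ ((3 : ℝ) / 5) := by positivity
  have hTinv : (n : ℝ) ^ (-(3 : ℝ) / 5) * (n : ℝ) ^ ((3 : ℝ) / 5) = 1 := by
    rw [← Real.rpow_add hN]; norm_num
  have hTe : (n : ℝ) * (n : ℝ) ^ (-((2 : ℝ) / 5)) = (n : ℝ) ^ ((3 : ℝ) / 5) := by
    nth_rewrite 1 [← Real.rpow_one (n : ℝ)]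
    rw [← Real.rpow_add hN]; norm_num
  have hT53 : (n : ℝ) ^ ((3 : ℝ) / 5) * ((n : ℝ) ^ ((3 : ℝ) / 5)) ^ ((2 : ℝ) / 3) = n := by
    rw [← Real.rpow_mul hN.le, ← Real.rpow_add hN]; norm_num
  have hD : l₀ n - (((2 * m n : ℝ) - 2 * n) * (n : ℝ) ^ (-(3 : ℝ) / 5)) *
      (n : ℝ) ^ ((3 : ℝ) / 5) / 2 = n - m n + l₀ n := by
    rw [mul_assoc, hTinv]; ring
  rw [hD]
  have he0 : (0 : ℝ) ≤ (n : ℝ) ^ (-((2 : ℝ) / 5)) := by positivity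
  generalize (n : ℝ) ^ (-((2 : ℝ) / 5)) = e at *
  generalize (n : ℝ) ^ ((3 : ℝ) / 5) = T at *
  generalize (n : ℝ) ^ (-(3 : ℝ) / 5) = S at *
  have hDpos : (0 : ℝ) < n - m n + l₀ n := by linarith
  have hS : S = 1 / T := by field_simp; linarith
  have key := aux_bounds A B K (l₀ n / T) ((n - m n + l₀ n) / T) e hA hB hK
    (by positivity) (by positivity) ?_ he0 ?_ ?_
  · obtain ⟨k1, k2, k3, k4⟩ := key
    exact ⟨⟨(le_div_iff₀ hT).mp k1, (div_le_iff₀ hT).mp k2⟩, hDpos,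
      (le_div_iff₀ hT).mp k3, (div_le_iff₀ hT).mp k4⟩
  · have h1 : l₀ n / T - (n - m n + l₀ n) / T = (((2 * m n : ℝ) - 2 * n) * S) / 2 := by
      rw [hS]; field_simp; ring
    rw [h1, abs_div, abs_two]
    have := abs_nonneg (((2 * m n : ℝ) - 2 * n) * S)
    linarith
  · rw [lt_div_iff₀ (by positivity)] at he
    linarith
  · rw [Real.div_rpow hDpos.le hT.le]
    have hT2 : 0 < T ^ ((2 : ℝ) / 3) := by positivity
    generalize T ^ ((2 : ℝ) / 3) = U at *
    generalize ((n : ℝ) - m n + l₀ n) ^ ((2 : ℝ) / 3) = V at *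
    have h1 : A * l₀ n * V = B * (n - 2 * (n - m n + l₀ n)) := by
      rw [hAdef]; linear_combination heq
    have h2 : A * (l₀ n / T) * (V / U) = (A * l₀ n * V) / n := by
      rw [← hT53]; field_simp
    have h3 : e = T / n := by field_simp; linarith
    rw [h2, h1, h3]
    field_simp
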